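/- For every r > 0: v″(r)/(v′(r))² = (β−1)/(β r^{β}) + (β̄−1)/(β r^{β̄}); and for every r ≥ 1: (β̄−1)/(β r^{β̄}) ≤ v″(r)/(v′(r))² ≤ 2(β−1)/(β r^{β̄}). -/

import Mathlib

open Filter Set

noncomputable section

/-- The auxiliary function `v(r) = ∫₀^{r^β} (1 + τ^p)⁻¹ dτ`. -/
def auxv (β p : ℝ) (r : ℝ) : ℝ := ∫ τ in (0 : ℝ)..(r ^ β), (1 + τ ^ p)⁻¹

lemma hasDerivAt_auxv {β p r : ℝ} (hp : 0 ≤ p) (hr : 0 < r) :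
    HasDerivAt (auxv β p) (β * r ^ (β - 1) / (1 + r ^ (β * p))) r := by
  have hcont : ∀ τ : ℝ, 0 ≤ τ → ContinuousAt (fun τ : ℝ => (1 + τ ^ p)⁻¹) τ := fun τ hτ =>
    (continuousAt_const.add (Real.continuousAt_rpow_const τ p (Or.inr hp))).inv₀
      (add_pos_of_pos_of_nonneg one_pos (Real.rpow_nonneg hτ p)).ne'
  have hrβ : 0 < r ^ β := Real.rpow_pos_of_pos hr β
  have hint : IntervalIntegrable (fun τ : ℝ => (1 + τ ^ p)⁻¹) MeasureTheory.volume 0 (r ^ β) := by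
    refine ContinuousOn.intervalIntegrable fun τ hτ => (hcont τ ?_).continuousWithinAt
    rw [uIcc_of_le hrβ.le] at hτ
    exact hτ.1
  have hmeas : Measurable (fun τ : ℝ => (1 + τ ^ p)⁻¹) := by fun_prop
  have hftc := intervalIntegral.integral_hasDerivAt_right hint
    hmeas.stronglyMeasurable.stronglyMeasurableAtFilter (hcont _ hrβ.le)
  refine (hftc.comp r (Real.hasDerivAt_rpow_const (p := β) (Or.inl hr.ne'))).congr_deriv ?_
  rw [Real.rpow_mul hr.le]
  ring

lemma hasDerivAt_deriv_auxv {β p r : ℝ} (hp : 0 ≤ p) (hr : 0 < r) :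
    HasDerivAt (deriv (auxv β p))
      ((β * ((β - 1) * r ^ (β - 1 - 1)) * (1 + r ^ (β * p))
        - β * r ^ (β - 1) * (β * p * r ^ (β * p - 1))) / (1 + r ^ (β * p)) ^ 2) r := by
  have hpos := Real.rpow_pos_of_pos hr (β * p)
  have hquot := ((Real.hasDerivAt_rpow_const (p := β - 1) (Or.inl hr.ne')).const_mul β).div
    ((Real.hasDerivAt_rpow_const (p := β * p) (Or.inl hr.ne')).const_add 1)
    (by positivity)
  refine hquot.congr_of_eventuallyEq ?_
  filter_upwards [lt_mem_nhds hr] with x hx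
  exact (hasDerivAt_auxv hp hx).deriv

lemma deriv_deriv_auxv_div_sq {β p r : ℝ} (hβ : β ≠ 0) (hp : 0 ≤ p) (hr : 0 < r) :
    deriv (deriv (auxv β p)) r / (deriv (auxv β p) r) ^ 2
      = (β - 1) / (β * r ^ β) + (β - β * p - 1) / (β * r ^ (β - β * p)) := by
  rw [(hasDerivAt_deriv_auxv hp hr).deriv, (hasDerivAt_auxv hp hr).deriv]
  have hq := Real.rpow_pos_of_pos hr (β * p)
  have hb := Real.rpow_pos_of_pos hr β
  have hden : 1 + r ^ (β * p) ≠ 0 := by positivity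
  simp only [Real.rpow_sub hr, Real.rpow_one]
  field_simp
  ring

theorem statement11 (βb β : ℝ) (hβb : 1 < βb) (hββ : βb < β)
    (p : ℝ) (hp : p = (β - βb) / β) :
    (∀ r : ℝ, 0 < r →
      deriv (deriv (auxv β p)) r / (deriv (auxv β p) r) ^ 2
        = (β - 1) / (β * r ^ β) + (βb - 1) / (β * r ^ βb)) ∧
    (∀ r : ℝ, 1 ≤ r →
      (βb - 1) / (β * r ^ βb) ≤ deriv (deriv (auxv β p)) r / (deriv (auxv β p) r) ^ 2 ∧
      deriv (deriv (auxv β p)) r / (deriv (auxv β p) r) ^ 2 ≤ 2 * (β - 1) / (β * r ^ βb)) := by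
  have hβ : 0 < β := by linarith
  have hp0 : 0 ≤ p := hp ▸ div_nonneg (by linarith) hβ.le
  have hβp : β - β * p = βb := by rw [hp]; field_simp; ring
  have hformula : ∀ r : ℝ, 0 < r →
      deriv (deriv (auxv β p)) r / (deriv (auxv β p) r) ^ 2
        = (β - 1) / (β * r ^ β) + (βb - 1) / (β * r ^ βb) := fun r hr => by
    rw [deriv_deriv_auxv_div_sq hβ.ne' hp0 hr, hβp]
  refine ⟨hformula, fun r hr => ?_⟩
  have hr0 : 0 < r := by linarith
  have hb := Real.rpow_pos_of_pos hr0 β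
  have hbb := Real.rpow_pos_of_pos hr0 βb
  have hβ1 : 0 ≤ β - 1 := by linarith
  rw [hformula r hr0]
  constructor
  · have : 0 ≤ (β - 1) / (β * r ^ β) := by positivity
    linarith
  · have hle : (β - 1) / (β * r ^ β) ≤ (β - 1) / (β * r ^ βb) := by gcongr
    have hle' : (βb - 1) / (β * r ^ βb) ≤ (β - 1) / (β * r ^ βb) := by gcongr
    calc _ ≤ (β - 1) / (β * r ^ βb) + (β - 1) / (β * r ^ βb) := add_le_add hle hle'
      _ = 2 * (β - 1) / (β * r ^ βb) := by ring
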